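/- Let q, d ≥ 1 be integers, ζ ∈ ℂ a primitive q-th root of unity, D = diag(ζ⁰, ζ¹, …, ζ^{q−1}) ∈ M_q(ℂ), K = C_{U(qd)}(D ⊗ I_d) the group of unitaries in U(qd) commuting with D ⊗ I_d, and H = I_q ⊗ U(d) ≤ K. Let P : U(qd)/H → U(qd)/K be the natural projection, fix a metric ρ inducing the topology of the compact metrizable space U(qd)/K, fix b₀ ∈ U(qd)/K, and let γ : S¹ → U(qd)/H be a continuous loop with image contained in the fiber P⁻¹(b₀). Then the following are equivalent: (i) γ is nullhomotopic within the subspace P⁻¹(b₀); (ii) for every ε > 0 there exists a homotopy H̃ : S¹ × [0,1] → U(qd)/H from γ to a constant map such that for every s ∈ [0,1] the set P(H̃(S¹ × {s})) has ρ-diameter less than ε. -/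

import Mathlib

open Kronecker

lemma star_kronecker_star {m n : Type*} [Fintype m] [Fintype n] [DecidableEq m] [DecidableEq n]
    (A : Matrix m m ℂ) (B : Matrix n n ℂ) : star (A ⊗ₖ B) = star A ⊗ₖ star B := by
  ext ⟨i, i'⟩ ⟨j, j'⟩
  simp [Matrix.star_apply, Matrix.kroneckerMap_apply, star_mul', Matrix.conjTranspose_apply,
    mul_comm]

/-- The group `C_{U(qd)}(X)` of unitaries in `U(qd)` commuting with a fixed matrix
`X ∈ M_{qd}(ℂ)`. -/
def unitaryCommutant (q d : ℕ) (X : Matrix (Fin q × Fin d) (Fin q × Fin d) ℂ) :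
    Subgroup (Matrix.unitaryGroup (Fin q × Fin d) ℂ) where
  carrier := {u | (u : Matrix (Fin q × Fin d) (Fin q × Fin d) ℂ) * X = X * u}
  one_mem' := by simp
  mul_mem' := by
    intro a b ha hb
    simp only [Set.mem_setOf_eq, Matrix.UnitaryGroup.mul_val] at ha hb ⊢
    rw [mul_assoc, hb, ← mul_assoc, ha, mul_assoc]
  inv_mem' := by
    intro a ha
    simp only [Set.mem_setOf_eq, Matrix.UnitaryGroup.inv_val] at ha ⊢
    have h1 : star a.1 * a.1 = 1 := Matrix.mem_unitaryGroup_iff'.mp a.prop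
    have h2 : a.1 * star a.1 = 1 := Matrix.mem_unitaryGroup_iff.mp a.prop
    calc star a.1 * X
        = star a.1 * X * (a.1 * star a.1) := by rw [h2, mul_one]
      _ = star a.1 * (X * a.1) * star a.1 := by
          rw [← mul_assoc, mul_assoc (star a.1) X a.1]
      _ = star a.1 * (a.1 * X) * star a.1 := by rw [ha]
      _ = star a.1 * a.1 * X * star a.1 := by rw [← mul_assoc (star a.1) a.1 X]
      _ = X * star a.1 := by rw [h1, one_mul]

/-- The closed subgroup `I_q ⊗ U(d) = {I_q ⊗ v : v ∈ U(d)}` of `U(qd)`. -/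
def oneTensorUnitary (q d : ℕ) : Subgroup (Matrix.unitaryGroup (Fin q × Fin d) ℂ) where
  carrier := {u | ∃ v : Matrix.unitaryGroup (Fin d) ℂ,
    (u : Matrix (Fin q × Fin d) (Fin q × Fin d) ℂ)
      = (1 : Matrix (Fin q) (Fin q) ℂ) ⊗ₖ (v : Matrix (Fin d) (Fin d) ℂ)}
  one_mem' := ⟨1, by simp [Matrix.one_kronecker_one]⟩
  mul_mem' := by
    rintro a b ⟨v, hv⟩ ⟨w, hw⟩
    refine ⟨v * w, ?_⟩
    have hvw : ((v * w : Matrix.unitaryGroup (Fin d) ℂ) : Matrix (Fin d) (Fin d) ℂ)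
        = (v : Matrix (Fin d) (Fin d) ℂ) * w := rfl
    rw [Matrix.UnitaryGroup.mul_val, hv, hw, hvw, ← Matrix.mul_kronecker_mul, one_mul]
  inv_mem' := by
    rintro a ⟨v, hv⟩
    refine ⟨v⁻¹, ?_⟩
    rw [Matrix.UnitaryGroup.inv_val, hv, star_kronecker_star, star_one,
      Matrix.UnitaryGroup.inv_val]

lemma oneTensorUnitary_le_unitaryCommutant (q d : ℕ) (X : Matrix (Fin q) (Fin q) ℂ) :
    oneTensorUnitary q d ≤ unitaryCommutant q d (X ⊗ₖ (1 : Matrix (Fin d) (Fin d) ℂ)) := by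
  rintro u ⟨v, hv⟩
  show (u : Matrix (Fin q × Fin d) (Fin q × Fin d) ℂ) * (X ⊗ₖ (1 : Matrix (Fin d) (Fin d) ℂ))
      = (X ⊗ₖ (1 : Matrix (Fin d) (Fin d) ℂ)) * (u : Matrix (Fin q × Fin d) (Fin q × Fin d) ℂ)
  rw [hv, ← Matrix.mul_kronecker_mul, ← Matrix.mul_kronecker_mul, one_mul, mul_one, one_mul,
    mul_one]

/-- The natural projection `U(qd)/(I_q ⊗ U(d)) → U(qd)/C_{U(qd)}(X ⊗ I_d)`, sending `uH` to
`uK`. -/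
def cosetProj (q d : ℕ) (X : Matrix (Fin q) (Fin q) ℂ) :
    (Matrix.unitaryGroup (Fin q × Fin d) ℂ ⧸ oneTensorUnitary q d) →
      (Matrix.unitaryGroup (Fin q × Fin d) ℂ ⧸
        unitaryCommutant q d (X ⊗ₖ (1 : Matrix (Fin d) (Fin d) ℂ))) :=
  Quotient.map' id (fun a b hab => by
    rw [QuotientGroup.leftRel_apply] at hab ⊢
    exact oneTensorUnitary_le_unitaryCommutant q d X hab)


set_option linter.unusedSectionVars false

lemma thin_eps {X : Type*} [TopologicalSpace X] [CompactSpace X] (ρ : X → X → ℝ)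
    (hρ_symm : ∀ x y, ρ x y = ρ y x)
    (hρ_eq : ∀ x y, ρ x y = 0 ↔ x = y)
    (hρ_tri : ∀ x y z, ρ x z ≤ ρ x y + ρ y z)
    (hρ_top : ∀ s : Set X, IsOpen s ↔ ∀ x ∈ s, ∃ ε > 0, {y | ρ x y < ε} ⊆ s)
    (N : Set (X × X)) (hN : IsOpen N) (hd : ∀ x, (x, x) ∈ N) :
    ∃ ε > 0, ∀ x y, ρ x y < ε → (x, y) ∈ N := by
  let m : PseudoMetricSpace X :=
    { dist := ρ
      dist_self := fun x => (hρ_eq x x).2 rfl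
      dist_comm := hρ_symm
      dist_triangle := hρ_tri }
  have ht : ‹TopologicalSpace X› = m.toUniformSpace.toTopologicalSpace := by
    ext s
    rw [hρ_top s, Metric.isOpen_iff]
    refine forall₂_congr fun x _ => exists_congr fun e => and_congr Iff.rfl ?_
    have : {y | ρ x y < e} = Metric.ball x e := by
      ext y
      rw [Metric.mem_ball, dist_comm]
      rfl
    rw [this]
  subst ht
  have h1 : N ∈ uniformity X := by
    rw [← nhdsSet_diagonal_eq_uniformity]
    rw [hN.mem_nhdsSet]
    rintro ⟨x, y⟩ h
    obtain rfl : x = y := h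
    exact hd x
  obtain ⟨e, he, h⟩ := Metric.mem_uniformity_dist.1 h1
  exact ⟨e, he, fun x y hxy => h hxy⟩

section abs
variable {G : Type*} [Group G] [TopologicalSpace G] [IsTopologicalGroup G]
  (H K : Subgroup G) (Ω : Set G) (r : G → G)

/-- the data of an equivariant local retraction to `K` -/
structure LocRetr : Prop where
  op : IsOpen Ω
  one : (1 : G) ∈ Ω
  left : ∀ k ∈ K, ∀ u ∈ Ω, k * u ∈ Ω
  right : ∀ k ∈ K, ∀ u ∈ Ω, u * k ∈ Ω
  cont : ContinuousOn r Ω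
  mem : ∀ u ∈ Ω, r u ∈ K
  equiv : ∀ k ∈ K, ∀ u ∈ Ω, r (u * k) = r u * k
  r_one : r 1 = 1

open Classical in
lemma exists_sec (h : LocRetr K Ω r) : ∃ σ : G ⧸ K → G, 
    ∀ u ∈ Ω, ContinuousAt σ (u : G ⧸ K) ∧ ((σ (u : G ⧸ K) : G) : G ⧸ K) = (u : G ⧸ K) := by
  have hinv : ∀ k ∈ K, ∀ u, u * k ∈ Ω → u ∈ Ω := fun k hk u hu => by
    simpa using h.right k⁻¹ (K.inv_mem hk) _ hu
  let f : G → G := fun u => if u ∈ Ω then u * (r u)⁻¹ else 1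
  have hf : ∀ a b : G, (QuotientGroup.leftRel K) a b → f a = f b := by
    intro a b hab
    rw [QuotientGroup.leftRel_apply] at hab
    obtain ⟨k, hk, rfl⟩ : ∃ k ∈ K, b = a * k := ⟨_, hab, by simp⟩
    by_cases ha : a ∈ Ω
    · simp only [f, if_pos ha, if_pos (h.right k hk a ha), h.equiv k hk a ha]
      group
    · have : a * k ∉ Ω := fun hh => ha (hinv k hk a hh)
      simp only [f, if_neg ha, if_neg this]
  let σ : G ⧸ K → G := Quotient.lift f hf
  refine ⟨σ, fun u hu => ⟨?_, ?_⟩⟩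
  · have := (QuotientGroup.isOpenQuotientMap_mk (N := K)).continuousAt_comp_iff (g := σ) (x := u)
    rw [← this]
    have h2 : ContinuousAt (fun u => u * (r u)⁻¹) u :=
      continuousAt_id.mul ((h.cont.continuousAt (h.op.mem_nhds hu)).inv)
    refine h2.congr ?_
    filter_upwards [h.op.mem_nhds hu] with v hv
    show _ = f v
    simp only [f, if_pos hv]
  · have : σ (u : G ⧸ K) = u * (r u)⁻¹ := by
      show f u = _
      simp only [f, if_pos hu]
    rw [this]
    refine QuotientGroup.eq.2 ?_
    simpa using h.mem u hu

open Classical in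
lemma exists_retr (hHK : H ≤ K) (h : LocRetr K Ω r) : ∃ R : G ⧸ H → G ⧸ H, 
    (∀ u ∈ Ω, ContinuousAt R (u : G ⧸ H) ∧ ∃ k ∈ K, R (u : G ⧸ H) = (k : G ⧸ H)) ∧
    ∀ k ∈ K, R (k : G ⧸ H) = (k : G ⧸ H) := by
  have hinv : ∀ k ∈ K, ∀ u, u * k ∈ Ω → u ∈ Ω := fun k hk u hu => by
    simpa using h.right k⁻¹ (K.inv_mem hk) _ hu
  let f : G → G ⧸ H := fun u => if u ∈ Ω then (r u : G ⧸ H) else (1 : G)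
  have hf : ∀ a b : G, (QuotientGroup.leftRel H) a b → f a = f b := by
    intro a b hab
    rw [QuotientGroup.leftRel_apply] at hab
    obtain ⟨k, hk, rfl⟩ : ∃ k ∈ H, b = a * k := ⟨_, hab, by simp⟩
    by_cases ha : a ∈ Ω
    · simp only [f, if_pos ha, if_pos (h.right k (hHK hk) a ha), h.equiv k (hHK hk) a ha]
      exact QuotientGroup.eq.2 (by simpa using hk)
    · have : a * k ∉ Ω := fun hh => ha (hinv k (hHK hk) a hh)
      simp only [f, if_neg ha, if_neg this]
  let R : G ⧸ H → G ⧸ H := Quotient.lift f hf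
  have hR : ∀ u ∈ Ω, R (u : G ⧸ H) = (r u : G ⧸ H) := by
    intro u hu
    show f u = _
    simp only [f, if_pos hu]
  refine ⟨R, fun u hu => ⟨?_, r u, h.mem u hu, hR u hu⟩, ?_⟩
  · have := (QuotientGroup.isOpenQuotientMap_mk (N := H)).continuousAt_comp_iff (g := R) (x := u)
    rw [← this]
    have h2 : ContinuousAt (fun u => (r u : G ⧸ H)) u :=
      QuotientGroup.continuous_mk.continuousAt.comp (h.cont.continuousAt (h.op.mem_nhds hu))
    refine h2.congr ?_
    filter_upwards [h.op.mem_nhds hu] with v hv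
    exact (hR v hv).symm
  · intro k hk
    have hk1 := h.right k hk 1 h.one
    have hk2 := h.equiv k hk 1 h.one
    rw [one_mul] at hk1 
    rw [one_mul, h.r_one, one_mul] at hk2
    rw [hR k hk1, hk2]

/-- near pairs of cosets -/
def nearSet : Set ((G ⧸ K) × (G ⧸ K)) :=
  (Prod.map (QuotientGroup.mk) (QuotientGroup.mk)) '' {p : G × G | p.2⁻¹ * p.1 ∈ Ω}

lemma nearSet_open (h : LocRetr K Ω r) : IsOpen (nearSet K Ω) := by
  refine (QuotientGroup.isOpenMap_coe.prodMap QuotientGroup.isOpenMap_coe) _ ?_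
  exact h.op.preimage (by fun_prop)

lemma nearSet_diag (h : LocRetr K Ω r) (x : G ⧸ K) : (x, x) ∈ nearSet K Ω := by
  obtain ⟨g, rfl⟩ := QuotientGroup.mk_surjective x
  exact ⟨(g, g), by simpa using h.one, rfl⟩

lemma nearSet_iff (h : LocRetr K Ω r) (u v : G) (huv : ((u : G ⧸ K), (v : G ⧸ K)) ∈ nearSet K Ω) :
    v⁻¹ * u ∈ Ω := by
  obtain ⟨⟨a, b⟩, hab, he⟩ := huv
  obtain ⟨h1, h2⟩ := Prod.mk.inj he
  have h1 := QuotientGroup.eq.1 h1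
  have h2 := QuotientGroup.eq.1 h2
  have := h.right _ h1 _ (h.left _ (K.inv_mem h2) _ hab)
  simpa [mul_assoc] using this

lemma path_lift (h : LocRetr K Ω r) (b : C(unitInterval, G ⧸ K)) :
    ∃ g : C(unitInterval, G), ∀ s, (g s : G ⧸ K) = b s := by
  obtain ⟨σ, hσ⟩ := exists_sec K Ω r h
  have h1 : (Prod.map b b) ⁻¹' (nearSet K Ω) ∈ uniformity unitInterval := by
    rw [← nhdsSet_diagonal_eq_uniformity]
    rw [((nearSet_open K Ω r h).preimage (by fun_prop)).mem_nhdsSet]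
    rintro ⟨x, y⟩ h'
    obtain rfl : x = y := h'
    exact nearSet_diag K Ω r h _
  obtain ⟨e, he, hb⟩ := Metric.mem_uniformity_dist.1 h1
  obtain ⟨n, hn⟩ := exists_nat_one_div_lt he
  let B : ℝ → G ⧸ K := fun t => b (Set.projIcc 0 1 zero_le_one t)
  have hBc : Continuous B := by
    exact b.continuous.comp continuous_projIcc
  have hB : ∀ s t : ℝ, |s - t| ≤ 1 / (n + 1) → (B s, B t) ∈ nearSet K Ω := by
    intro s t hst
    refine hb (lt_of_le_of_lt ?_ hn)
    refine le_trans ?_ hst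
    rw [Subtype.dist_eq, Real.dist_eq]
    exact Set.abs_projIcc_sub_projIcc _
  have key : ∀ k : ℕ, ∃ g : C(unitInterval, G), 
      ∀ s : unitInterval, (g s : G ⧸ K) = B (k * (s / (n + 1))) := by
    intro k
    induction k with
    | zero =>
      obtain ⟨x, hx⟩ := QuotientGroup.mk_surjective (B 0)
      exact ⟨ContinuousMap.const _ x, fun s => by simpa using hx⟩
    | succ k ih =>
      obtain ⟨g, hg⟩ := ih
      let c : unitInterval → G ⧸ K := fun s => B ((k + 1 : ℕ) * (s / (n + 1)))
      have hc : Continuous c := hBc.comp (by fun_prop)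
      have hmem : ∀ s, ∃ u ∈ Ω, (g s)⁻¹ • c s = (u : G ⧸ K) := by
        intro s
        obtain ⟨u, hu⟩ := QuotientGroup.mk_surjective (c s)
        refine ⟨(g s)⁻¹ * u, ?_, by rw [← hu]; rfl⟩
        apply nearSet_iff K Ω r h
        rw [hu, hg]
        apply hB
        have h3 : ((k + 1 : ℕ) * ((s : ℝ) / (n + 1)) - k * (s / (n + 1))) = s / (n + 1) := by
          push_cast; ring
        have hs0 := s.2.1
        have hs1 := s.2.2
        rw [h3, abs_of_nonneg (by positivity)]
        gcongr
      refine ⟨⟨fun s => g s * σ ((g s)⁻¹ • c s), ?_⟩, ?_⟩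
      · refine g.continuous.mul ?_
        rw [continuous_iff_continuousAt]
        intro s
        obtain ⟨u, hu, hus⟩ := hmem s
        have h4 : ContinuousAt (fun s => (g s)⁻¹ • c s) s := by
          have : Continuous (fun s => (g s)⁻¹ • c s) := by fun_prop
          exact this.continuousAt
        exact ContinuousAt.comp (g := σ) (by rw [hus]; exact (hσ u hu).1) h4
      · intro s
        obtain ⟨u, hu, hus⟩ := hmem s
        show g s • (((σ ((g s)⁻¹ • c s) : G)) : G ⧸ K) = c s
        rw [hus, (hσ u hu).2, ← hus, smul_inv_smul]
  obtain ⟨g, hg⟩ := key (n + 1)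
  refine ⟨g, fun s => ?_⟩
  rw [hg]
  have : ((n + 1 : ℕ) : ℝ) * ((s : ℝ) / (n + 1)) = s := by
    push_cast; field_simp
  rw [this]
  simp [B]

lemma thin_main (hHK : H ≤ K) (h : LocRetr K Ω r) (P : G ⧸ H → G ⧸ K)
    (hP : ∀ u : G, P (u : G ⧸ H) = (u : G ⧸ K)) (b₀ : G ⧸ K) (γ : C(Circle, G ⧸ H))
    (hγ : ∀ z, P (γ z) = b₀) (c : G ⧸ H)
    (F : ContinuousMap.Homotopy γ (ContinuousMap.const Circle c))
    (hF : ∀ s z z', (P (F (s, z)), P (F (s, z'))) ∈ nearSet K Ω) :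
    ContinuousMap.Nullhomotopic
        (⟨fun z => (⟨γ z, hγ z⟩ : (P ⁻¹' {b₀} : Set (G ⧸ H))),
          Continuous.subtype_mk γ.continuous _⟩ : C(Circle, (P ⁻¹' {b₀} : Set (G ⧸ H)))) := by
  have hPc : Continuous P := by
    rw [← (QuotientGroup.isOpenQuotientMap_mk (N := H)).continuous_comp_iff]
    have : P ∘ QuotientGroup.mk = (QuotientGroup.mk : G → G ⧸ K) := funext hP
    rw [this]
    exact QuotientGroup.continuous_mk
  have hPs : ∀ (g : G) (x : G ⧸ H), P (g • x) = g • P x := by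
    intro g x
    obtain ⟨u, rfl⟩ := QuotientGroup.mk_surjective x
    rw [hP]
    exact hP (g * u)
  obtain ⟨R, hR, hRK⟩ := exists_retr H K Ω r hHK h
  obtain ⟨g, hg⟩ := path_lift K Ω r h ⟨fun s => P (F (s, 1)), hPc.comp (by fun_prop)⟩
  simp only [ContinuousMap.coe_mk] at hg
  have hmem : ∀ s z, ∃ u ∈ Ω, (g s)⁻¹ • F (s, z) = (u : G ⧸ H) := by
    intro s z
    obtain ⟨u, hu⟩ := QuotientGroup.mk_surjective (F (s, z))
    refine ⟨(g s)⁻¹ * u, ?_, by rw [← hu]; rfl⟩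
    apply nearSet_iff K Ω r h
    rw [hg, ← hP u, hu]
    exact hF s z 1
  have hg0 : (g 0 : G ⧸ K) = b₀ := by rw [hg]; simp [hγ]
  let Φ : unitInterval × Circle → G ⧸ H := fun p => g 0 • R ((g p.1)⁻¹ • F p)
  have hΦc : Continuous Φ := by
    suffices hc : Continuous fun p : unitInterval × Circle => R ((g p.1)⁻¹ • F p) from
      hc.const_smul (g 0)
    rw [continuous_iff_continuousAt]
    rintro ⟨s, z⟩
    obtain ⟨u, hu, hus⟩ := hmem s z
    have h4 : ContinuousAt (fun p : unitInterval × Circle => (g p.1)⁻¹ • F p) (s, z) := by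
      have : Continuous (fun p : unitInterval × Circle => (g p.1)⁻¹ • F p) := by fun_prop
      exact this.continuousAt
    exact ContinuousAt.comp (g := R) (by
      show ContinuousAt R ((g s)⁻¹ • F (s, z))
      rw [hus]; exact (hR u hu).1) h4
  have hΦP : ∀ p, P (Φ p) = b₀ := by
    rintro ⟨s, z⟩
    obtain ⟨u, hu, hus⟩ := hmem s z
    obtain ⟨-, k, hk, hRk⟩ := hR u hu
    show P (g 0 • R ((g s)⁻¹ • F (s, z))) = b₀
    rw [hus, hRk, hPs, hP, ← hg0]
    exact QuotientGroup.eq.2 (by simpa using hk)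
  have hΦ0 : ∀ z, Φ (0, z) = γ z := by
    intro z
    show g 0 • R ((g 0)⁻¹ • F (0, z)) = γ z
    rw [F.apply_zero]
    obtain ⟨u, hu⟩ := QuotientGroup.mk_surjective (γ z)
    have hk : (g 0)⁻¹ * u ∈ K := by
      rw [← QuotientGroup.eq, hg0, ← hP u, hu, hγ]
    have := hRK _ hk
    rw [← hu]
    have e : (g 0)⁻¹ • (u : G ⧸ H) = (((g 0)⁻¹ * u : G) : G ⧸ H) := rfl
    rw [e, this, ← e, smul_inv_smul]
  refine ⟨⟨g 0 • R ((g 1)⁻¹ • c), ?_⟩, ⟨⟨⟨fun p => ⟨Φ p, hΦP p⟩, hΦc.subtype_mk _⟩, ?_, ?_⟩⟩⟩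
  · have := hΦP (1, 1)
    simpa [Φ] using this
  · intro z
    exact Subtype.ext (hΦ0 z)
  · intro z
    apply Subtype.ext
    show Φ (1, z) = _
    simp [Φ]

end abs

section conc
open scoped Matrix.Norms.L2Operator MatrixOrder

/-- unitary polar part -/
noncomputable def polPart {n : Type*} [Fintype n] [DecidableEq n] (M : Matrix n n ℂ) :
    Matrix n n ℂ := Ring.inverse (CFC.sqrt (M * star M)) * M

lemma polPart_sqrt_isUnit {n : Type*} [Fintype n] [DecidableEq n] {M : Matrix n n ℂ}
    (hM : IsUnit M) : IsUnit (CFC.sqrt (M * star M)) := by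
  have h1 : IsUnit (M * star M) := hM.mul hM.star
  rw [← CFC.sqrt_mul_sqrt_self (M * star M) (mul_star_self_nonneg M)] at h1
  exact ((Commute.refl _).isUnit_mul_iff.1 h1).1

lemma polPart_unitary {n : Type*} [Fintype n] [DecidableEq n] {M : Matrix n n ℂ}
    (hM : IsUnit M) : polPart M ∈ Matrix.unitaryGroup n ℂ := by
  rw [Matrix.mem_unitaryGroup_iff, polPart, star_mul]
  have hS := polPart_sqrt_isUnit hM
  have h2 := CFC.sqrt_mul_sqrt_self (M * star M) (mul_star_self_nonneg M)
  have h3 : star (CFC.sqrt (M * star M)) = CFC.sqrt (M * star M) :=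
    (CFC.sqrt_nonneg (M * star M)).star_eq
  set S := CFC.sqrt (M * star M)
  have h4 : star (Ring.inverse S) = Ring.inverse S := by
    rw [← Ring.inverse_star, h3]
  rw [h4]
  calc Ring.inverse S * M * (star M * Ring.inverse S) = Ring.inverse S * (M * star M) * Ring.inverse S := by simp only [mul_assoc]
    _ = (Ring.inverse S * S) * (S * Ring.inverse S) := by rw [← h2]; simp only [mul_assoc]
    _ = 1 := by rw [Ring.inverse_mul_cancel _ hS, Ring.mul_inverse_cancel _ hS, one_mul]

lemma polPart_cont {n : Type*} [Fintype n] [DecidableEq n] :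
    ContinuousOn (polPart (n := n)) {M | IsUnit M} := by
  have h0 : Continuous fun M : Matrix n n ℂ => M * star M := by fun_prop
  have h1 : Continuous fun M : Matrix n n ℂ => CFC.sqrt (M * star M) :=
    CFC.continuousOn_sqrt.comp_continuous h0 (fun M => mul_star_self_nonneg M)
  intro M hM
  refine ContinuousAt.continuousWithinAt ?_
  suffices hc : ContinuousAt (fun M : Matrix n n ℂ => Ring.inverse (CFC.sqrt (M * star M))) M from
    hc.mul continuousAt_id
  obtain ⟨u, hu⟩ := polPart_sqrt_isUnit hM
  refine ContinuousAt.comp (g := Ring.inverse) ?_ h1.continuousAt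
  rw [← hu]
  exact NormedRing.inverse_continuousAt u

lemma polPart_comm {n : Type*} [Fintype n] [DecidableEq n] {M X : Matrix n n ℂ}
    (hM : IsUnit M) (h1 : Commute M X) (h2 : Commute (star M) X) : Commute (polPart M) X := by
  rw [polPart]
  refine Commute.mul_left ?_ h1
  have h3 : Commute (CFC.sqrt (M * star M)) X := (h1.mul_left h2).cfcₙ_nnreal _
  obtain ⟨u, hu⟩ := polPart_sqrt_isUnit hM
  rw [← hu] at h3 ⊢
  rw [Ring.inverse_unit]
  exact h3.units_inv_left

lemma polPart_mul {n : Type*} [Fintype n] [DecidableEq n] {M k : Matrix n n ℂ}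
    (hk : k * star k = 1) : polPart (M * k) = polPart M * k := by
  have : M * k * star (M * k) = M * star M := by
    rw [star_mul, mul_assoc, ← mul_assoc k, hk, one_mul]
  rw [polPart, polPart, this, mul_assoc]

lemma polPart_one {n : Type*} [Fintype n] [DecidableEq n] :
    polPart (1 : Matrix n n ℂ) = 1 := by
  simp [polPart]

instance unitary_compact {n : Type*} [Fintype n] [DecidableEq n] :
    CompactSpace (Matrix.unitaryGroup n ℂ) := by
  refine (isCompact_iff_compactSpace (s := (Matrix.unitaryGroup n ℂ : Set (Matrix n n ℂ)))).1 ?_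
  refine Metric.isCompact_of_isClosed_isBounded ?_ ?_
  · have : (Matrix.unitaryGroup n ℂ : Set (Matrix n n ℂ)) = {M | M * star M = 1} := by
      ext M
      exact Matrix.mem_unitaryGroup_iff
    rw [this]
    exact isClosed_eq (by fun_prop) continuous_const
  · rw [isBounded_iff_forall_norm_le]
    refine ⟨1, fun U hU => ?_⟩
    have h := CStarRing.norm_self_mul_star (x := U)
    rw [Matrix.mem_unitaryGroup_iff.1 hU] at h
    have h1 : ‖(1 : Matrix n n ℂ)‖ ≤ 1 := by
      rcases subsingleton_or_nontrivial (Matrix n n ℂ) with hs | hs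
      · rw [Subsingleton.elim (1 : Matrix n n ℂ) 0]; simp
      · exact (CStarRing.norm_one).le
    nlinarith [norm_nonneg U]

/-- block diagonal part -/
def blkPart {q d : ℕ} (u : Matrix (Fin q × Fin d) (Fin q × Fin d) ℂ) :
    Matrix (Fin q × Fin d) (Fin q × Fin d) ℂ :=
  Matrix.of fun x y => if x.1 = y.1 then u x y else 0

lemma blkPart_apply {q d : ℕ} (u : Matrix (Fin q × Fin d) (Fin q × Fin d) ℂ) (x y) :
    blkPart u x y = if x.1 = y.1 then u x y else 0 := rfl

lemma blkPart_cont {q d : ℕ} : Continuous (blkPart (q := q) (d := d)) := by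
  refine continuous_matrix fun x y => ?_
  simp only [blkPart_apply]
  split_ifs
  · exact continuous_id.matrix_elem x y
  · exact continuous_const

lemma blkPart_one {q d : ℕ} :
    blkPart (1 : Matrix (Fin q × Fin d) (Fin q × Fin d) ℂ) = 1 := by
  ext x y
  rw [blkPart_apply]
  by_cases h : x = y
  · simp [h]
  · simp [Matrix.one_apply_ne h]

lemma blkPart_star {q d : ℕ} (u : Matrix (Fin q × Fin d) (Fin q × Fin d) ℂ) :
    star (blkPart u) = blkPart (star u) := by
  ext x y
  simp only [Matrix.star_apply, blkPart_apply, eq_comm (a := y.1)]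
  split_ifs <;> simp

lemma blkPart_mul_right {q d : ℕ} (u k : Matrix (Fin q × Fin d) (Fin q × Fin d) ℂ)
    (hk : ∀ x y, x.1 ≠ y.1 → k x y = 0) : blkPart (u * k) = blkPart u * k := by
  ext x y
  simp only [blkPart_apply, Matrix.mul_apply]
  split_ifs with h
  · refine Finset.sum_congr rfl fun j _ => ?_
    by_cases hj : j.1 = y.1
    · rw [if_pos (h.trans hj.symm)]
    · rw [hk j y hj]; simp
  · symm
    refine Finset.sum_eq_zero fun j _ => ?_
    by_cases hj : j.1 = y.1
    · rw [if_neg (fun h' => h (h'.trans hj)), zero_mul]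
    · rw [hk j y hj]; simp

lemma blkPart_mul_left {q d : ℕ} (u k : Matrix (Fin q × Fin d) (Fin q × Fin d) ℂ)
    (hk : ∀ x y, x.1 ≠ y.1 → k x y = 0) : blkPart (k * u) = k * blkPart u := by
  apply star_injective
  rw [blkPart_star, star_mul, star_mul, blkPart_star, blkPart_mul_right]
  intro x y hxy
  rw [Matrix.star_apply, hk y x hxy.symm, star_zero]

lemma clock_kron (q d : ℕ) (ζ : ℂ) :
    (Matrix.diagonal fun i : Fin q => ζ ^ (i : ℕ)) ⊗ₖ (1 : Matrix (Fin d) (Fin d) ℂ)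
      = Matrix.diagonal fun x : Fin q × Fin d => ζ ^ (x.1 : ℕ) := by
  rw [← Matrix.diagonal_one, Matrix.diagonal_kronecker_diagonal]
  simp

lemma blkPart_commute (q d : ℕ) (ζ : ℂ) (u : Matrix (Fin q × Fin d) (Fin q × Fin d) ℂ) :
    Commute (blkPart u)
      ((Matrix.diagonal fun i : Fin q => ζ ^ (i : ℕ)) ⊗ₖ (1 : Matrix (Fin d) (Fin d) ℂ)) := by
  rw [clock_kron]
  show _ * _ = _ * _
  ext x y
  rw [Matrix.mul_diagonal, Matrix.diagonal_mul, blkPart_apply]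
  split_ifs with h
  · rw [h, mul_comm]
  · simp

lemma commutant_block (q d : ℕ) (ζ : ℂ) (hζ : IsPrimitiveRoot ζ q)
    (k : Matrix.unitaryGroup (Fin q × Fin d) ℂ)
    (hk : k ∈ unitaryCommutant q d
      ((Matrix.diagonal fun i : Fin q => ζ ^ (i : ℕ)) ⊗ₖ (1 : Matrix (Fin d) (Fin d) ℂ))) :
    ∀ x y, x.1 ≠ y.1 → (k : Matrix (Fin q × Fin d) (Fin q × Fin d) ℂ) x y = 0 := by
  intro x y hxy
  have hk : (k : Matrix (Fin q × Fin d) (Fin q × Fin d) ℂ) * _ = _ * k := hk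
  rw [clock_kron] at hk
  have h := congrFun (congrFun hk x) y
  rw [Matrix.mul_diagonal, Matrix.diagonal_mul] at h
  by_contra h0
  rw [mul_comm] at h
  have h1 := mul_right_cancel₀ h0 h
  exact hxy (Fin.ext (hζ.pow_inj x.1.2 y.1.2 h1.symm))

open Classical in
lemma exists_locRetr (q d : ℕ) (ζ : ℂ) (hζ : IsPrimitiveRoot ζ q) :
    ∃ Ω r, LocRetr (unitaryCommutant q d
      ((Matrix.diagonal fun i : Fin q => ζ ^ (i : ℕ)) ⊗ₖ (1 : Matrix (Fin d) (Fin d) ℂ))) Ω r := by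
  have hblk := commutant_block q d ζ hζ
  have hunit : ∀ k : Matrix.unitaryGroup (Fin q × Fin d) ℂ,
      IsUnit (k : Matrix (Fin q × Fin d) (Fin q × Fin d) ℂ) := fun k =>
    (Unitary.toUnits k).isUnit
  let Ω : Set (Matrix.unitaryGroup (Fin q × Fin d) ℂ) :=
    {u | IsUnit (blkPart (u : Matrix (Fin q × Fin d) (Fin q × Fin d) ℂ))}
  let r : Matrix.unitaryGroup (Fin q × Fin d) ℂ → Matrix.unitaryGroup (Fin q × Fin d) ℂ :=
    fun u => if h : u ∈ Ω then ⟨polPart (blkPart u), polPart_unitary h⟩ else 1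
  have hr : ∀ u ∈ Ω, (r u : Matrix (Fin q × Fin d) (Fin q × Fin d) ℂ) = polPart (blkPart u) := by
    intro u hu
    simp only [r, dif_pos hu]
  have hone : (1 : Matrix.unitaryGroup (Fin q × Fin d) ℂ) ∈ Ω := by
    show IsUnit (blkPart (1 : Matrix (Fin q × Fin d) (Fin q × Fin d) ℂ))
    rw [blkPart_one]
    exact isUnit_one
  have hright : ∀ k ∈ unitaryCommutant q d
      ((Matrix.diagonal fun i : Fin q => ζ ^ (i : ℕ)) ⊗ₖ (1 : Matrix (Fin d) (Fin d) ℂ)),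
      ∀ u ∈ Ω, u * k ∈ Ω := by
    intro k hk u hu
    show IsUnit (blkPart (u.1 * k.1))
    rw [blkPart_mul_right _ _ (hblk k hk)]
    exact IsUnit.mul hu (hunit k)
  refine ⟨Ω, r, ?_, hone, ?_, hright, ?_, ?_, ?_, ?_⟩
  · exact (Units.isOpen (R := Matrix (Fin q × Fin d) (Fin q × Fin d) ℂ)).preimage
      (blkPart_cont.comp continuous_subtype_val)
  · intro k hk u hu
    show IsUnit (blkPart (k.1 * u.1))
    rw [blkPart_mul_left _ _ (hblk k hk)]
    exact IsUnit.mul (hunit k) hu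
  · rw [Topology.IsInducing.subtypeVal.continuousOn_iff]
    have : ContinuousOn (fun u : Matrix.unitaryGroup (Fin q × Fin d) ℂ =>
        polPart (blkPart (u : Matrix (Fin q × Fin d) (Fin q × Fin d) ℂ))) Ω :=
      polPart_cont.comp (blkPart_cont.comp continuous_subtype_val).continuousOn (fun u hu => hu)
    exact this.congr hr
  · intro u hu
    show (r u : Matrix (Fin q × Fin d) (Fin q × Fin d) ℂ) * _ = _ * _
    rw [hr u hu]
    exact polPart_comm hu (blkPart_commute q d ζ _)
      (by rw [blkPart_star]; exact blkPart_commute q d ζ _)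
  · intro k hk u hu
    apply Subtype.ext
    rw [hr _ (hright k hk u hu)]
    show polPart (blkPart (u.1 * k.1)) = (r u).1 * k.1
    rw [hr u hu, blkPart_mul_right _ _ (hblk k hk), polPart_mul (Matrix.mem_unitaryGroup_iff.1 k.2)]
  · apply Subtype.ext
    rw [hr _ hone]
    show polPart (blkPart (1 : Matrix (Fin q × Fin d) (Fin q × Fin d) ℂ)) = 1
    rw [blkPart_one, polPart_one]

end conc

/-- In the setting of the projection
`P : U(qd)/H → U(qd)/K` (`H = I_q ⊗ U(d)`, `K = C_{U(qd)}(D ⊗ I_d)`, `D` the clock matrix of a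
primitive `q`-th root of unity), fix a metric `ρ` inducing the quotient topology on `U(qd)/K`, a
point `b₀`, and a continuous loop `γ : S¹ → U(qd)/H` with image inside the fiber `P⁻¹(b₀)`.
Then `γ` is nullhomotopic within the subspace `P⁻¹(b₀)` if and only if for every `ε > 0` it
admits a homotopy to a constant map whose every time-slice has image of `ρ`-`P`-diameter less
than `ε`. -/
theorem nullhomotopic_in_fiber_iff_arbitrarily_thin_homotopies
    (q d : ℕ) (hq : 1 ≤ q) (hd : 1 ≤ d)
    (ζ : ℂ) (hζ : IsPrimitiveRoot ζ q)
    (D : Matrix (Fin q) (Fin q) ℂ) (hD : D = Matrix.diagonal fun i : Fin q => ζ ^ (i : ℕ))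
    (ρ : (Matrix.unitaryGroup (Fin q × Fin d) ℂ ⧸
          unitaryCommutant q d (D ⊗ₖ (1 : Matrix (Fin d) (Fin d) ℂ))) →
        (Matrix.unitaryGroup (Fin q × Fin d) ℂ ⧸
          unitaryCommutant q d (D ⊗ₖ (1 : Matrix (Fin d) (Fin d) ℂ))) → ℝ)
    (hρ_symm : ∀ x y, ρ x y = ρ y x)
    (hρ_eq : ∀ x y, ρ x y = 0 ↔ x = y)
    (hρ_tri : ∀ x y z, ρ x z ≤ ρ x y + ρ y z)
    (hρ_top : ∀ s : Set (Matrix.unitaryGroup (Fin q × Fin d) ℂ ⧸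
          unitaryCommutant q d (D ⊗ₖ (1 : Matrix (Fin d) (Fin d) ℂ))),
        IsOpen s ↔ ∀ x ∈ s, ∃ ε > 0, {y | ρ x y < ε} ⊆ s)
    (b₀ : Matrix.unitaryGroup (Fin q × Fin d) ℂ ⧸
        unitaryCommutant q d (D ⊗ₖ (1 : Matrix (Fin d) (Fin d) ℂ)))
    (γ : C(Circle, Matrix.unitaryGroup (Fin q × Fin d) ℂ ⧸ oneTensorUnitary q d))
    (hγ : ∀ z, cosetProj q d D (γ z) = b₀) :
    ContinuousMap.Nullhomotopic
        (⟨fun z => (⟨γ z, hγ z⟩ : (cosetProj q d D ⁻¹' {b₀} :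
            Set (Matrix.unitaryGroup (Fin q × Fin d) ℂ ⧸ oneTensorUnitary q d))),
          Continuous.subtype_mk γ.continuous _⟩ :
          C(Circle, (cosetProj q d D ⁻¹' {b₀} :
            Set (Matrix.unitaryGroup (Fin q × Fin d) ℂ ⧸ oneTensorUnitary q d))))
      ↔ ∀ ε > (0 : ℝ),
          ∃ (c : Matrix.unitaryGroup (Fin q × Fin d) ℂ ⧸ oneTensorUnitary q d)
            (F : ContinuousMap.Homotopy γ (ContinuousMap.const Circle c)),
            ∀ (s : unitInterval) (z z' : Circle),
              ρ (cosetProj q d D (F (s, z))) (cosetProj q d D (F (s, z'))) < ε := by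
  subst hD
  constructor
  · rintro ⟨c, ⟨F⟩⟩ ε hε
    refine ⟨c, ⟨⟨fun p => (F p : _ ⧸ _), by fun_prop⟩, fun z => ?_, fun z => ?_⟩, ?_⟩
    · simp
    · simp
    · intro s z z'
      have h1 := (F (s, z)).2
      have h2 := (F (s, z')).2
      simp only [Set.mem_preimage, Set.mem_singleton_iff] at h1 h2
      show ρ (cosetProj q d _ (F (s, z))) (cosetProj q d _ (F (s, z'))) < ε
      rw [h1, h2, (hρ_eq b₀ b₀).2 rfl]
      exact hε
  · intro hthin
    obtain ⟨Ω, r, h⟩ := exists_locRetr q d ζ hζ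
    obtain ⟨ε, hε, hN⟩ := thin_eps ρ hρ_symm hρ_eq hρ_tri hρ_top _
      (nearSet_open _ Ω r h) (nearSet_diag _ Ω r h)
    obtain ⟨c, F, hF⟩ := hthin ε hε
    exact thin_main _ _ Ω r (oneTensorUnitary_le_unitaryCommutant q d _) h
      (cosetProj q d _) (fun u => rfl) b₀ γ hγ c F (fun s z z' => hN _ _ (hF s z z'))
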